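/- arXiv:0901.0017 — 5 statements merged into one kernel-verified Lean document; each statement's English description precedes it below -/
import Mathlib

section
/- Let (X, μ) be a σ-finite measure space and Θ a parameter set. For each θ ∈ Θ let f(·; θ) : X → ℝ be a measurable positive function (the complete-data density) with g(θ) := ∫ f(x; θ) dμ(x) ∈ (0, ∞), and define the conditional density k(x; θ) := f(x; θ)/g(θ), the log-likelihood l(θ) := log g(θ), the EM Q-function Q(θ, θ̄) := ∫ (log f(x; θ)) k(x; θ̄) dμ(x), and the Kullback divergence I(θ, θ̄) := ∫ log(k(x; θ̄)/k(x; θ)) k(x; θ̄) dμ(x). Assume that for all θ, θ̄ ∈ Θ the functions x ↦ (log f(x; θ)) k(x; θ̄) and x ↦ (log k(x; θ̄)) k(x; θ̄) and x ↦ (log k(x; θ)) k(x; θ̄) are μ-integrable. Then for all θ, θ̄ ∈ Θ one has l(θ) − I(θ, θ̄) = Q(θ, θ̄) − ∫ (log k(x; θ̄)) k(x; θ̄) dμ(x); consequently, for every θ̄ ∈ Θ, a point θ⁺ ∈ Θ maximizes Q(·, θ̄) over Θ if and only if it maximizes θ ↦ l(θ) − I(θ, θ̄) over Θ. (The EM algorithm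 is the Kullback proximal algorithm with relaxation parameter β = 1.) -/
open MeasureTheory

/-- The EM algorithm is the Kullback proximal algorithm with β = 1:
the identity `l(θ) − I(θ, θ̄) = Q(θ, θ̄) − ∫ (log k(x; θ̄)) k(x; θ̄) dμ(x)` holds, and
consequently maximizing `Q(·, θ̄)` is the same as maximizing `l − I(·, θ̄)`. -/
theorem em_is_kullback_proximal
    {X : Type*} [MeasurableSpace X] (μ : Measure X) [SigmaFinite μ]
    {Θ : Type*} (f : Θ → X → ℝ)
    (hf_meas : ∀ θ, Measurable (f θ))
    (hf_pos : ∀ θ x, 0 < f θ x)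
    (hf_int : ∀ θ, Integrable (f θ) μ)
    (g : Θ → ℝ) (hg : ∀ θ, g θ = ∫ x, f θ x ∂μ)
    (hg_pos : ∀ θ, 0 < g θ)
    (k : Θ → X → ℝ) (hk : ∀ θ x, k θ x = f θ x / g θ)
    (l : Θ → ℝ) (hl : ∀ θ, l θ = Real.log (g θ))
    (Q : Θ → Θ → ℝ)
    (hQ : ∀ θ θbar, Q θ θbar = ∫ x, Real.log (f θ x) * k θbar x ∂μ)
    (I : Θ → Θ → ℝ)
    (hI : ∀ θ θbar, I θ θbar = ∫ x, Real.log (k θbar x / k θ x) * k θbar x ∂μ)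
    (hint1 : ∀ θ θbar, Integrable (fun x => Real.log (f θ x) * k θbar x) μ)
    (hint2 : ∀ θbar, Integrable (fun x => Real.log (k θbar x) * k θbar x) μ)
    (hint3 : ∀ θ θbar, Integrable (fun x => Real.log (k θ x) * k θbar x) μ) :
    (∀ θ θbar, l θ - I θ θbar
        = Q θ θbar - ∫ x, Real.log (k θbar x) * k θbar x ∂μ) ∧
    (∀ θbar θplus, (∀ θ, Q θ θbar ≤ Q θplus θbar) ↔
        (∀ θ, l θ - I θ θbar ≤ l θplus - I θplus θbar)) := by
  have hk_int : ∀ θ, Integrable (k θ) μ := fun θ => by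
    rw [funext (hk θ)]
    exact (hf_int θ).div_const _
  have hk_one : ∀ θ, ∫ x, k θ x ∂μ = 1 := fun θ => by
    simp only [hk]
    rw [integral_div, ← hg, div_self (hg_pos θ).ne']
  have hk_pos : ∀ θ x, 0 < k θ x := fun θ x => by
    rw [hk]
    exact div_pos (hf_pos θ x) (hg_pos θ)
  have key : ∀ θ θbar, l θ - I θ θbar
      = Q θ θbar - ∫ x, Real.log (k θbar x) * k θbar x ∂μ := fun θ θbar => by
    have hdiff : Integrable
        (fun x => Real.log (k θbar x) * k θbar x - Real.log (f θ x) * k θbar x) μ :=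
      (hint2 θbar).sub (hint1 θ θbar)
    have hsplit : ∀ x, Real.log (k θbar x / k θ x) * k θbar x
        = Real.log (k θbar x) * k θbar x - Real.log (f θ x) * k θbar x
          + Real.log (g θ) * k θbar x := fun x => by
      rw [Real.log_div (hk_pos θbar x).ne' (hk_pos θ x).ne', hk θ x,
        Real.log_div (hf_pos θ x).ne' (hg_pos θ).ne']
      ring
    rw [hI, hQ, hl]
    simp only [hsplit]
    rw [integral_add hdiff ((hk_int θbar).const_mul _),
      integral_sub (hint2 θbar) (hint1 θ θbar), integral_const_mul, hk_one]
    ring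
  exact ⟨key, fun θbar θplus => by simp only [key, sub_le_sub_iff_right]⟩
end

section
/- Let Θ ⊆ ℝ^p, let L : ℝ^p → ℝ, let I : ℝ^p × ℝ^p → ℝ satisfy I(θ, θ') ≥ 0 for all θ, θ' and I(θ, θ) = 0 for all θ, and let (β_k) be a sequence of nonnegative reals. Suppose the sequence (θ^k) in Θ satisfies: for each k, θ^{k+1} maximizes θ ↦ L(θ) − β_k I(θ, θ^k) over a set of parameters that contains θ^k. If there exists a subsequence (θ^{σ(k)}) contained in a compact set C on which L is continuous, then lim_{k→∞} β_k I(θ^{k+1}, θ^k) = 0. -/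
open Filter Topology

/-- If a subsequence of the penalized Kullback proximal sequence lies in a compact set on
which `L` is continuous, then `β_k I(θ^{k+1}, θ^k) → 0`. -/
theorem kullback_proximal_residual_tendsto_zero {p : ℕ}
    (Θ : Set (Fin p → ℝ)) (L : (Fin p → ℝ) → ℝ)
    (I : (Fin p → ℝ) → (Fin p → ℝ) → ℝ)
    (hI_nonneg : ∀ θ θ', 0 ≤ I θ θ')
    (hI_diag : ∀ θ, I θ θ = 0)
    (β : ℕ → ℝ) (hβ : ∀ k, 0 ≤ β k)
    (θseq : ℕ → (Fin p → ℝ)) (hθΘ : ∀ k, θseq k ∈ Θ)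
    (S : ℕ → Set (Fin p → ℝ))
    (hSmem : ∀ k, θseq k ∈ S k)
    (hmax : ∀ k, θseq (k + 1) ∈ S k ∧
      ∀ θ ∈ S k, L θ - β k * I θ (θseq k)
        ≤ L (θseq (k + 1)) - β k * I (θseq (k + 1)) (θseq k))
    (C : Set (Fin p → ℝ)) (hC : IsCompact C) (hLC : ContinuousOn L C)
    (σ : ℕ → ℕ) (hσ : StrictMono σ) (hsub : ∀ k, θseq (σ k) ∈ C) :
    Tendsto (fun k => β k * I (θseq (k + 1)) (θseq k)) atTop (𝓝 0) := by
  have hstep : ∀ k, β k * I (θseq (k + 1)) (θseq k) ≤ L (θseq (k + 1)) - L (θseq k) := by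
    intro k
    have h := (hmax k).2 (θseq k) (hSmem k)
    rw [hI_diag, mul_zero, sub_zero] at h
    linarith
  have hres : ∀ k, 0 ≤ β k * I (θseq (k + 1)) (θseq k) := fun k =>
    mul_nonneg (hβ k) (hI_nonneg _ _)
  have hmono : Monotone fun k => L (θseq k) :=
    monotone_nat_of_le_succ fun k => by linarith [hstep k, hres k]
  obtain ⟨M, hM⟩ := hC.bddAbove_image hLC
  have hbdd : BddAbove (Set.range fun k => L (θseq k)) := by
    refine ⟨M, ?_⟩
    rintro _ ⟨k, rfl⟩
    exact (hmono (hσ.id_le k)).trans (hM (Set.mem_image_of_mem L (hsub k)))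
  have hlim := tendsto_atTop_ciSup hmono hbdd
  have hdiff : Tendsto (fun k => L (θseq (k + 1)) - L (θseq k)) atTop (𝓝 0) := by
    simpa using (hlim.comp (tendsto_add_atTop_nat 1)).sub hlim
  exact squeeze_zero hres hstep hdiff
end

section
/- Let φ : (0, ∞) → ℝ be nonnegative, convex and differentiable, with φ(τ) = 0 if and only if τ = 1, and liminf_{τ→∞} φ(τ) > 0. Let J be a finite index set, let α_j ≥ 0 for j ∈ J, and let t_j : ℝ^p → (0, ∞) be continuous functions for j ∈ J. Define I(η, θ) := Σ_{j∈J} α_j t_j(η) φ( t_j(θ)/t_j(η) ). Let (θ^k) and (η^k) be sequences in ℝ^p with (η^k) bounded. If lim_{k→∞} I(η^k, θ^k) = 0, then for every j ∈ J with α_j > 0, lim_{k→∞} | t_j(η^k) − t_j(θ^k) | = 0. -/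
open Filter Topology

/-- If a convex function on `(0, ∞)` is nonnegative and vanishes only at `1`, then its values
along a positive family can tend to `0` only if the family tends to `1`. -/
theorem ConvexOn.tendsto_one_of_tendsto_zero {ι : Type*} {l : Filter ι} {φ : ℝ → ℝ}
    (hconv : ConvexOn ℝ (Set.Ioi (0 : ℝ)) φ) (hnonneg : ∀ τ : ℝ, 0 < τ → 0 ≤ φ τ)
    (hzero : ∀ τ : ℝ, 0 < τ → (φ τ = 0 ↔ τ = 1)) {u : ι → ℝ} (hu : ∀ i, 0 < u i)
    (h : Tendsto (fun i => φ (u i)) l (𝓝 0)) : Tendsto u l (𝓝 1) := by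
  have hone : φ 1 = 0 := (hzero 1 one_pos).2 rfl
  have hpos : ∀ b : ℝ, 0 < b → b ≠ 1 → 0 < φ b := fun b hb hne =>
    (hnonneg b hb).lt_of_ne fun h0 => hne ((hzero b hb).1 h0.symm)
  refine tendsto_order.2 ⟨fun a ha => ?_, fun a ha => ?_⟩
  · have hb : 0 < max a (1 / 2) := lt_max_of_lt_right (by norm_num)
    have hb1 : max a (1 / 2) < 1 := max_lt ha (by norm_num)
    filter_upwards [h.eventually_lt_const (hpos _ hb hb1.ne)] with i hi
    by_contra! hle
    have hmem : max a (1 / 2) ∈ Set.Icc (u i) 1 := ⟨hle.trans (le_max_left _ _), hb1.le⟩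
    have := hconv.le_max_of_mem_Icc (hu i) (Set.mem_Ioi.2 one_pos) hmem
    rw [hone, max_eq_left (hnonneg _ (hu i))] at this
    exact this.not_gt hi
  · have ha0 : 0 < a := one_pos.trans ha
    filter_upwards [h.eventually_lt_const (hpos _ ha0 ha.ne')] with i hi
    by_contra! hle
    have := hconv.le_max_of_mem_Icc (Set.mem_Ioi.2 one_pos) (hu i) ⟨ha.le, hle⟩
    rw [hone, max_eq_right (hnonneg _ (hu i))] at this
    exact this.not_gt hi

/-- If the φ-divergence `I(η^k, θ^k) = Σ_j α_j t_j(η^k) φ(t_j(θ^k)/t_j(η^k))` tends to `0`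
and `(η^k)` is bounded, then `|t_j(η^k) − t_j(θ^k)| → 0` for every `j` with `α_j > 0`. -/
theorem phi_divergence_forces_convergence {p : ℕ}
    (φ : ℝ → ℝ)
    (hφ_nonneg : ∀ τ : ℝ, 0 < τ → 0 ≤ φ τ)
    (hφ_convex : ConvexOn ℝ (Set.Ioi (0 : ℝ)) φ)
    (hφ_diff : DifferentiableOn ℝ φ (Set.Ioi (0 : ℝ)))
    (hφ_zero : ∀ τ : ℝ, 0 < τ → (φ τ = 0 ↔ τ = 1))
    (hφ_liminf : ∃ ρ : ℝ, 0 < ρ ∧ ∀ᶠ τ in atTop, ρ ≤ φ τ)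
    {J : Type*} [Fintype J]
    (α : J → ℝ) (hα : ∀ j, 0 ≤ α j)
    (t : J → (Fin p → ℝ) → ℝ)
    (ht_cont : ∀ j, Continuous (t j))
    (ht_pos : ∀ j θ, 0 < t j θ)
    (I : (Fin p → ℝ) → (Fin p → ℝ) → ℝ)
    (hI : ∀ η θ, I η θ = ∑ j, α j * t j η * φ (t j θ / t j η))
    (θseq ηseq : ℕ → (Fin p → ℝ))
    (hη_bdd : ∃ C : ℝ, ∀ k, ‖ηseq k‖ ≤ C)
    (hI_tendsto : Tendsto (fun k => I (ηseq k) (θseq k)) atTop (𝓝 0)) :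
    ∀ j, 0 < α j →
      Tendsto (fun k => |t j (ηseq k) - t j (θseq k)|) atTop (𝓝 0) := by
  intro j hj
  obtain ⟨C, hC⟩ := hη_bdd
  have hmem : ∀ k, ηseq k ∈ Metric.closedBall (0 : Fin p → ℝ) C := fun k => by
    simpa using hC k
  have hcomp : IsCompact (Metric.closedBall (0 : Fin p → ℝ) C) := isCompact_closedBall 0 C
  obtain ⟨x, -, hx⟩ := hcomp.exists_isMinOn ⟨_, hmem 0⟩ (ht_cont j).continuousOn
  obtain ⟨y, -, hy⟩ := hcomp.exists_isMaxOn ⟨_, hmem 0⟩ (ht_cont j).continuousOn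
  have hmin : ∀ k, t j x ≤ t j (ηseq k) := fun k => hx (hmem k)
  have hmax : ∀ k, t j (ηseq k) ≤ t j y := fun k => hy (hmem k)
  have hτ : ∀ i k, 0 < t i (θseq k) / t i (ηseq k) := fun i k =>
    div_pos (ht_pos _ _) (ht_pos _ _)
  have hc : 0 < α j * t j x := mul_pos hj (ht_pos j x)
  have hφ : Tendsto (fun k => φ (t j (θseq k) / t j (ηseq k))) atTop (𝓝 0) := by
    have hlim : Tendsto (fun k => I (ηseq k) (θseq k) / (α j * t j x)) atTop (𝓝 0) := by
      simpa using hI_tendsto.div_const (α j * t j x)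
    refine squeeze_zero (fun k => hφ_nonneg _ (hτ j k)) (fun k => ?_) hlim
    rw [le_div_iff₀ hc, hI, mul_comm]
    calc α j * t j x * φ (t j (θseq k) / t j (ηseq k))
        ≤ α j * t j (ηseq k) * φ (t j (θseq k) / t j (ηseq k)) :=
          mul_le_mul_of_nonneg_right (mul_le_mul_of_nonneg_left (hmin k) hj.le)
            (hφ_nonneg _ (hτ j k))
      _ ≤ ∑ i, α i * t i (ηseq k) * φ (t i (θseq k) / t i (ηseq k)) :=
          Finset.single_le_sum
            (f := fun i => α i * t i (ηseq k) * φ (t i (θseq k) / t i (ηseq k)))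
            (fun i _ => mul_nonneg (mul_nonneg (hα i) (ht_pos _ _).le) (hφ_nonneg _ (hτ i k)))
            (Finset.mem_univ j)
  have hratio := hφ_convex.tendsto_one_of_tendsto_zero hφ_nonneg hφ_zero (hτ j) hφ
  have hlim : Tendsto (fun k => t j y * |1 - t j (θseq k) / t j (ηseq k)|) atTop (𝓝 0) := by
    simpa using ((hratio.const_sub 1).abs).const_mul (t j y)
  refine squeeze_zero (fun k => abs_nonneg _) (fun k => ?_) hlim
  have hne : t j (ηseq k) ≠ 0 := (ht_pos _ _).ne'
  calc |t j (ηseq k) - t j (θseq k)|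
      = t j (ηseq k) * |1 - t j (θseq k) / t j (ηseq k)| := by
        rw [← abs_of_pos (ht_pos j (ηseq k)), ← abs_mul, abs_of_pos (ht_pos j (ηseq k)),
          mul_sub, mul_one, mul_div_cancel₀ _ hne]
    _ ≤ t j y * |1 - t j (θseq k) / t j (ηseq k)| :=
        mul_le_mul_of_nonneg_right (hmax k) (abs_nonneg _)
end

section
/- Let φ : (0, ∞) → ℝ be nonnegative, convex and differentiable, with φ(τ) = 0 if and only if τ = 1, and liminf_{τ→∞} φ(τ) > 0. Let (a_k) and (b_k) be sequences of positive real numbers such that a_k φ(b_k / a_k) → 0 as k → ∞. Then b_k → +∞ if and only if a_k → +∞. -/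
open Filter Topology

/-- A convex function on `(0, ∞)` vanishing at `1` lies above the secant line through `1` and `2`
to the right of `2`. -/
lemma ConvexOn.mul_sub_one_le_of_two_lt {φ : ℝ → ℝ} (hφ : ConvexOn ℝ (Set.Ioi (0 : ℝ)) φ)
    (h1 : φ 1 = 0) {τ : ℝ} (hτ : 2 < τ) : φ 2 * (τ - 1) ≤ φ τ := by
  have h := hφ.slope_mono_adjacent (x := 1) (y := 2) (z := τ) (Set.mem_Ioi.2 one_pos)
    (Set.mem_Ioi.2 (by linarith)) (by norm_num) hτ
  rw [h1, le_div_iff₀ (by linarith)] at h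
  linarith

/-- A convex function on `(0, ∞)` that vanishes at `1` and is nonnegative at `1 / 2` is at least
its value at `1 / 2` on `(0, 1 / 2)`. -/
lemma ConvexOn.half_le_of_lt_half {φ : ℝ → ℝ} (hφ : ConvexOn ℝ (Set.Ioi (0 : ℝ)) φ)
    (h1 : φ 1 = 0) (h_half : 0 ≤ φ (1 / 2)) {τ : ℝ} (hτ0 : 0 < τ) (hτ : τ < 1 / 2) :
    φ (1 / 2) ≤ φ τ := by
  have h := hφ.slope_mono_adjacent (x := τ) (y := 1 / 2) (z := 1) (Set.mem_Ioi.2 hτ0)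
    (Set.mem_Ioi.2 one_pos) hτ (by norm_num)
  rw [h1, div_le_iff₀ (by linarith), sub_half] at h
  have h_mul : 0 ≤ φ (1 / 2) * (1 / 2 - τ) := mul_nonneg h_half (by linarith)
  linarith

/-- If `a_k φ(b_k/a_k) → 0` for positive sequences `(a_k)`, `(b_k)` and a nonnegative convex
differentiable `φ` vanishing exactly at `1` with `liminf_{τ→∞} φ(τ) > 0`, then
`b_k → +∞` iff `a_k → +∞`. -/
theorem phi_divergence_infinite_coordinates
    (φ : ℝ → ℝ)
    (hφ_nonneg : ∀ τ : ℝ, 0 < τ → 0 ≤ φ τ)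
    (hφ_convex : ConvexOn ℝ (Set.Ioi (0 : ℝ)) φ)
    (hφ_diff : DifferentiableOn ℝ φ (Set.Ioi (0 : ℝ)))
    (hφ_zero : ∀ τ : ℝ, 0 < τ → (φ τ = 0 ↔ τ = 1))
    (hφ_liminf : ∃ ρ : ℝ, 0 < ρ ∧ ∀ᶠ τ in atTop, ρ ≤ φ τ)
    (a b : ℕ → ℝ) (ha : ∀ k, 0 < a k) (hb : ∀ k, 0 < b k)
    (h0 : Tendsto (fun k => a k * φ (b k / a k)) atTop (𝓝 0)) :
    Tendsto b atTop atTop ↔ Tendsto a atTop atTop := by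
  have h1 : φ 1 = 0 := (hφ_zero 1 one_pos).2 rfl
  have h_pos : ∀ τ : ℝ, 0 < τ → τ ≠ 1 → 0 < φ τ := fun τ hτ hne =>
    (hφ_nonneg τ hτ).lt_of_ne' fun h => hne ((hφ_zero τ hτ).1 h)
  have h2 : 0 < φ 2 := h_pos 2 (by norm_num) (by norm_num)
  have h_half : 0 < φ (1 / 2) := h_pos (1 / 2) (by norm_num) (by norm_num)
  have h_lt : ∀ᶠ k in atTop, a k * φ (b k / a k) < 1 := h0.eventually_lt_const one_pos
  constructor
  · intro hb_top
    refine tendsto_atTop_mono' atTop ?_ (hb_top.atTop_div_const two_pos)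
    filter_upwards [h_lt, hb_top.eventually_ge_atTop (2 / φ 2)] with k hk hbk
    by_contra! hlt
    have hτ : 2 < b k / a k := by
      rw [lt_div_iff₀ (ha k)]
      linarith
    have h_secant := mul_le_mul_of_nonneg_left (hφ_convex.mul_sub_one_le_of_two_lt h1 hτ) (ha k).le
    have h_eq : a k * (φ 2 * (b k / a k - 1)) = φ 2 * (b k - a k) := by
      have := (ha k).ne'
      field_simp
    rw [div_le_iff₀ h2] at hbk
    nlinarith
  · intro ha_top
    refine tendsto_atTop_mono' atTop ?_ (ha_top.atTop_div_const two_pos)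
    filter_upwards [h_lt, ha_top.eventually_ge_atTop (1 / φ (1 / 2))] with k hk hak
    by_contra! hlt
    have hτ : b k / a k < 1 / 2 := by
      rw [div_lt_iff₀ (ha k)]
      linarith
    have h_le := mul_le_mul_of_nonneg_left
      (hφ_convex.half_le_of_lt_half h1 h_half.le (div_pos (hb k) (ha k)) hτ) (ha k).le
    rw [div_le_iff₀ h_half] at hak
    linarith
end

section
/- Let D ⊆ ℝ^p × ℝ^p be open, let L : ℝ^p → ℝ be continuous, and let I : D → ℝ be continuous with I(θ, θ') ≥ 0 for all (θ, θ') ∈ D and I(θ, θ) = 0 whenever (θ, θ) ∈ D. Let (β_k) be nonnegative reals with β_k → β*. Suppose the sequence (θ^k) satisfies: for each k, θ^{k+1} maximizes θ ↦ L(θ) − β_k I(θ, θ^k) over { θ : (θ, θ^k) ∈ D }. Let θ* be such that (θ*, θ*) ∈ D and suppose there is a subsequence with θ^{σ(k)} → θ* and θ^{σ(k)+1} → θ*. Then for every θ with (θ, θ*) ∈ D, L(θ*) ≥ L(θ) − β* I(θ, θ*); that is, θ* maximizes θ ↦ L(θ) − β* I(θ, θ*) over { θ : (θ, θ*) ∈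 D }. -/
open Filter Topology

/-- Any cluster point `θ*` of the penalized Kullback proximal sequence (with limits of the
iterates and their successors both equal to `θ*`) maximizes `θ ↦ L(θ) − β* I(θ, θ*)` over
`{θ : (θ, θ*) ∈ D}`. -/
theorem cluster_point_maximizes {p : ℕ}
    (D : Set ((Fin p → ℝ) × (Fin p → ℝ))) (hD : IsOpen D)
    (L : (Fin p → ℝ) → ℝ) (hL : Continuous L)
    (I : (Fin p → ℝ) × (Fin p → ℝ) → ℝ) (hI_cont : ContinuousOn I D)
    (hI_nonneg : ∀ q ∈ D, 0 ≤ I q)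
    (hI_diag : ∀ θ : Fin p → ℝ, (θ, θ) ∈ D → I (θ, θ) = 0)
    (β : ℕ → ℝ) (hβ_nonneg : ∀ k, 0 ≤ β k)
    (βstar : ℝ) (hβ_lim : Tendsto β atTop (𝓝 βstar))
    (θseq : ℕ → (Fin p → ℝ))
    (hmax : ∀ k, (θseq (k + 1), θseq k) ∈ D ∧
      ∀ θ : Fin p → ℝ, (θ, θseq k) ∈ D →
        L θ - β k * I (θ, θseq k)
          ≤ L (θseq (k + 1)) - β k * I (θseq (k + 1), θseq k))
    (θstar : Fin p → ℝ) (hθstar : (θstar, θstar) ∈ D)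
    (σ : ℕ → ℕ) (hσ : StrictMono σ)
    (hconv : Tendsto (fun k => θseq (σ k)) atTop (𝓝 θstar))
    (hconv' : Tendsto (fun k => θseq (σ k + 1)) atTop (𝓝 θstar)) :
    ∀ θ : Fin p → ℝ, (θ, θstar) ∈ D → L θ - βstar * I (θ, θstar) ≤ L θstar := by
  intro θ hθ
  have hpair : Tendsto (fun k => (θ, θseq (σ k))) atTop (𝓝 (θ, θstar)) :=
    tendsto_const_nhds.prodMk_nhds hconv
  have hI_lim : Tendsto (fun k => I (θ, θseq (σ k))) atTop (𝓝 (I (θ, θstar))) :=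
    (hI_cont.continuousAt (hD.mem_nhds hθ)).tendsto.comp hpair
  have hlhs := (tendsto_const_nhds (x := L θ)).sub
    ((hβ_lim.comp hσ.tendsto_atTop).mul hI_lim)
  refine le_of_tendsto_of_tendsto hlhs ((hL.tendsto θstar).comp hconv') ?_
  filter_upwards [hpair.eventually (hD.mem_nhds hθ)] with k hk
  obtain ⟨hmem, hle⟩ := hmax (σ k)
  exact (hle θ hk).trans (sub_le_self _ (mul_nonneg (hβ_nonneg _) (hI_nonneg _ hmem)))
end
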